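/- Let G ∈ H^∞_{m×p} with T_G T_G* strictly positive, and set Ξ(z) = Y(z)Ξ₀ and θ(z) = Y(z)Θ₀. Then Ξ ∈ H²_{p×m}, θ ∈ H^∞_{p×(p−m)} is inner with ran T_θ = ker T_G, and for every V ∈ H²_{(p−m)×m} the function X(z) = Ξ(z) + θ(z)V(z) belongs to H²_{p×m} and satisfies G(z)X(z) = I_m on 𝔻; every X ∈ H²_{p×m} with G(z)X(z) = I_m on 𝔻 arises this way; moreover ‖X(·)u‖²_{H²_p} = ‖Ξ(·)u‖²_{H²_p} + ‖V(·)u‖²_{H²_{p−m}} for every u ∈ ℂᵐ, so Ξ is the least squares H² solution. -/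

import Mathlib

/-!
Setting: `l2 n` models ℓ²₊(ℂⁿ); `lp.single 2 0` is the canonical embedding `E_n`, and
evaluating a sequence at coordinate `k` realizes `E_n* (S_n*)^k`.  Block Toeplitz and
Hankel operators, as well as the (bounded) inverse of `T_G T_G*`, are specified through
their actions on the standard basis vectors of the coordinate spaces.
-/

noncomputable section
open scoped Matrix

/-- ℂⁿ with the Euclidean norm. -/
abbrev ES (n : ℕ) : Type := EuclideanSpace ℂ (Fin n)

/-- ℓ²₊(ℂⁿ). -/
abbrev l2 (n : ℕ) : Type := lp (fun _ : ℕ => ES n) 2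

/-- The `b`-th standard basis vector of ℂⁿ. -/
abbrev eVec (n : ℕ) (b : Fin n) : ES n := EuclideanSpace.single b 1

/-- The matrix function `z ↦ ∑' ν, z ^ ν • F ν` determined by a coefficient sequence. -/
def seriesM {r s : ℕ} (F : ℕ → Matrix (Fin r) (Fin s) ℂ) (z : ℂ) :
    Matrix (Fin r) (Fin s) ℂ :=
  Matrix.of fun a b => ∑' ν : ℕ, z ^ ν * F ν a b

lemma ES.sum_eVec {n : ℕ} (v : ES n) : ∑ b, v b • eVec n b = v := by
  ext i
  simp [Finset.sum_apply, Pi.single_apply]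

/-- The matrix action on Euclidean spaces. -/
def mulES {r s : ℕ} (M : Matrix (Fin r) (Fin s) ℂ) (v : ES s) : ES r :=
  WithLp.toLp 2 (M.mulVec v)

lemma mulES_apply {r s : ℕ} (M : Matrix (Fin r) (Fin s) ℂ) (v : ES s) (a : Fin r) :
    mulES M v a = ∑ b, M a b * v b := rfl

lemma l2.norm_sq {n : ℕ} (x : l2 n) : ‖x‖ ^ 2 = ∑' ν, ∑ a, ‖x ν a‖ ^ 2 := by
  have h := lp.norm_rpow_eq_tsum (p := 2) (by norm_num) x
  simp only [ENNReal.toReal_ofNat, Real.rpow_ofNat] at h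
  simp_rw [h, EuclideanSpace.norm_sq_eq]

lemma memℓp_two_of_coord {n : ℕ} {f : ℕ → ES n}
    (hf : ∀ a, Summable fun ν => ‖f ν a‖ ^ 2) : Memℓp (E := fun _ : ℕ => ES n) f 2 := by
  apply memℓp_gen
  simp only [ENNReal.toReal_ofNat, Real.rpow_ofNat, EuclideanSpace.norm_sq_eq]
  exact summable_sum fun a _ => hf a

lemma l2.summable_coord {n : ℕ} (x : l2 n) (a : Fin n) : Summable fun ν => ‖x ν a‖ ^ 2 := by
  have h := (lp.memℓp x).summable (by norm_num)
  simp only [ENNReal.toReal_ofNat, Real.rpow_ofNat] at h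
  refine h.of_nonneg_of_le (fun _ => by positivity) fun ν => ?_
  gcongr
  exact PiLp.norm_apply_le _ _

lemma l2.ext {n : ℕ} {x y : l2 n} (h : ∀ ν a, x ν a = y ν a) : x = y := by
  apply lp.ext
  funext ν
  ext a
  exact h ν a

/-- The element of `ℓ²₊(ℂⁿ)` with prescribed coordinates. -/
def l2.ofCoord {n : ℕ} (f : ℕ → ES n) (hf : ∀ a, Summable fun ν => ‖f ν a‖ ^ 2) : l2 n :=
  ⟨f, memℓp_two_of_coord hf⟩

@[simp] lemma l2.ofCoord_apply {n : ℕ} (f : ℕ → ES n)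
    (hf : ∀ a, Summable fun ν => ‖f ν a‖ ^ 2) (ν : ℕ) : l2.ofCoord f hf ν = f ν := rfl

/-- Prepend a zero to a sequence. -/
def prependZero {n : ℕ} (f : ℕ → ES n) : ℕ → ES n
  | 0 => 0
  | k + 1 => f k

lemma summable_prependZero {n : ℕ} {f : ℕ → ES n} (a : Fin n)
    (hf : Summable fun ν => ‖f ν a‖ ^ 2) : Summable fun ν => ‖prependZero f ν a‖ ^ 2 :=
  (summable_nat_add_iff (f := fun ν => ‖prependZero f ν a‖ ^ 2) 1).1 hf

/-- The forward shift. -/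
def fwdShift (n : ℕ) : l2 n →ₗᵢ[ℂ] l2 n where
  toFun x := l2.ofCoord (prependZero fun ν => x ν)
    fun a => summable_prependZero a (l2.summable_coord x a)
  map_add' x y := by
    refine l2.ext fun ν a => ?_
    cases ν <;> simp [prependZero]
  map_smul' c x := by
    refine l2.ext fun ν a => ?_
    cases ν <;> simp [prependZero]
  norm_map' x := by
    refine (sq_eq_sq₀ (norm_nonneg _) (norm_nonneg _)).1 ?_
    rw [l2.norm_sq, l2.norm_sq, Summable.tsum_eq_zero_add]
    · simp [prependZero]
    · exact summable_sum fun a _ => summable_prependZero a (l2.summable_coord x a)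

@[simp] lemma fwdShift_zero {n : ℕ} (x : l2 n) : fwdShift n x 0 = 0 := rfl

@[simp] lemma fwdShift_succ {n : ℕ} (x : l2 n) (ν : ℕ) : fwdShift n x (ν + 1) = x ν := rfl

/-- The backward shift. -/
def bwdShift (n : ℕ) : l2 n →L[ℂ] l2 n := (fwdShift n).toContinuousLinearMap.adjoint

lemma fwdShift_single {n : ℕ} (j : ℕ) (v : ES n) :
    fwdShift n (lp.single 2 j v) = lp.single 2 (j + 1) v := by
  refine l2.ext fun ν a => ?_
  cases ν with
  | zero => simp [lp.single_apply]
  | succ k => by_cases h : k = j <;> simp [lp.single_apply, h]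

lemma inner_fwdShift_left {n : ℕ} (x y : l2 n) :
    inner ℂ (fwdShift n x) y = inner ℂ x (bwdShift n y) :=
  (ContinuousLinearMap.adjoint_inner_right (fwdShift n).toContinuousLinearMap x y).symm

@[simp] lemma bwdShift_apply {n : ℕ} (x : l2 n) (ν : ℕ) : bwdShift n x ν = x (ν + 1) := by
  refine ext_inner_left ℂ fun v => ?_
  calc inner ℂ v (bwdShift n x ν) = inner ℂ (lp.single 2 ν v : l2 n) (bwdShift n x) :=
        (lp.inner_single_left (G := fun _ : ℕ => ES n) ν v (bwdShift n x)).symm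
    _ = inner ℂ (lp.single 2 (ν + 1) v : l2 n) x := by
        rw [← inner_fwdShift_left, fwdShift_single]
    _ = inner ℂ v (x (ν + 1)) := lp.inner_single_left _ _ _

lemma single_add_fwdShift_bwdShift {n : ℕ} (x : l2 n) :
    lp.single 2 0 (x 0) + fwdShift n (bwdShift n x) = x := by
  apply lp.ext
  funext ν
  cases ν <;> simp [lp.single_apply]

/-- The isometry `S ^ j` for the forward shift `S`. -/
def fwdShiftPow (n : ℕ) : ℕ → (l2 n →ₗᵢ[ℂ] l2 n)
  | 0 => LinearIsometry.id
  | j + 1 => (fwdShift n).comp (fwdShiftPow n j)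

@[simp] lemma fwdShiftPow_zero {n : ℕ} (x : l2 n) : fwdShiftPow n 0 x = x := rfl

@[simp] lemma fwdShiftPow_succ {n : ℕ} (j : ℕ) (x : l2 n) :
    fwdShiftPow n (j + 1) x = fwdShift n (fwdShiftPow n j x) := rfl

lemma fwdShiftPow_apply {n : ℕ} (j : ℕ) (x : l2 n) (i : ℕ) (a : Fin n) :
    fwdShiftPow n j x i a = if j ≤ i then x (i - j) a else 0 := by
  induction j generalizing i with
  | zero => simp
  | succ j ih => cases i <;> simp [ih]

/-- A bounded functional is determined by its values on the standard basis. -/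
lemma l2.hasSum_clm_apply {n : ℕ} (φ : l2 n →L[ℂ] ℂ) (x : l2 n) :
    HasSum (fun j => ∑ b, x j b * φ (lp.single 2 j (eVec n b))) (φ x) := by
  have h := (lp.hasSum_single (p := 2) (by norm_num) x).mapL φ
  convert h using 2 with j
  conv_rhs => rw [← ES.sum_eVec (x j)]
  have : lp.single (E := fun _ : ℕ => ES n) 2 j (∑ b, x j b • eVec n b)
      = ∑ b, x j b • lp.single 2 j (eVec n b) := by
    refine (map_sum (lp.lsingle (𝕜 := ℂ) (E := fun _ : ℕ => ES n) 2 j)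
      (fun b => x j b • eVec n b) Finset.univ).trans (Finset.sum_congr rfl fun b _ => ?_)
    exact map_smul (lp.lsingle (𝕜 := ℂ) (E := fun _ : ℕ => ES n) 2 j) (x j b) (eVec n b)
  rw [this]
  simp

/-- The coordinate functional. -/
def coordCLM (n i : ℕ) (a : Fin n) : l2 n →L[ℂ] ℂ :=
  (EuclideanSpace.proj a).comp (lp.evalCLM ℂ (fun _ : ℕ => ES n) 2 i)

@[simp] lemma coordCLM_apply {n i : ℕ} (a : Fin n) (x : l2 n) : coordCLM n i a x = x i a := rfl

lemma toeplitz_apply {r s : ℕ} {F : ℕ → Matrix (Fin r) (Fin s) ℂ} {T : l2 s →L[ℂ] l2 r}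
    (hT : ∀ (j : ℕ) (b : Fin s) (i : ℕ) (a : Fin r),
      (T (lp.single 2 j (eVec s b))) i a = if j ≤ i then F (i - j) a b else 0)
    (x : l2 s) (i : ℕ) (a : Fin r) :
    T x i a = ∑ j ∈ Finset.range (i + 1), ∑ b, F (i - j) a b * x j b := by
  have h := l2.hasSum_clm_apply ((coordCLM r i a).comp T) x
  simp only [ContinuousLinearMap.comp_apply, coordCLM_apply, hT] at h
  rw [h.unique (hasSum_sum_of_ne_finset_zero (s := Finset.range (i + 1)) fun j hj => ?_)]
  · refine Finset.sum_congr rfl fun j hj => Finset.sum_congr rfl fun b _ => ?_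
    rw [if_pos (by simpa [Nat.lt_succ_iff] using hj), mul_comm]
  · simp [show ¬ j ≤ i by simpa [Nat.lt_succ_iff] using hj]

lemma hankel_single_zero_apply {r s : ℕ} {F : ℕ → Matrix (Fin r) (Fin s) ℂ}
    {H : l2 s →L[ℂ] l2 r}
    (hH : ∀ (j : ℕ) (b : Fin s) (i : ℕ) (a : Fin r),
      (H (lp.single 2 j (eVec s b))) i a = F (i + j + 1) a b)
    (v : ES s) (i : ℕ) (a : Fin r) :
    H (lp.single 2 0 v) i a = ∑ b, F (i + 1) a b * v b := by
  have h := l2.hasSum_clm_apply ((coordCLM r i a).comp H) (lp.single 2 0 v)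
  simp only [ContinuousLinearMap.comp_apply, coordCLM_apply, hH] at h
  rw [h.unique (hasSum_single 0 fun j hj => ?_)]
  · simp [mul_comm]
  · simp [lp.single_apply, hj]

lemma toeplitz_fwdShift {r s : ℕ} {F : ℕ → Matrix (Fin r) (Fin s) ℂ} {T : l2 s →L[ℂ] l2 r}
    (hT : ∀ (j : ℕ) (b : Fin s) (i : ℕ) (a : Fin r),
      (T (lp.single 2 j (eVec s b))) i a = if j ≤ i then F (i - j) a b else 0)
    (x : l2 s) : T (fwdShift s x) = fwdShift r (T x) := by
  refine l2.ext fun i a => ?_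
  rw [toeplitz_apply hT]
  cases i with
  | zero => simp
  | succ i => simp [Finset.sum_range_succ' _ (i + 1), toeplitz_apply hT]

lemma bwdShift_toeplitz {r s : ℕ} {F : ℕ → Matrix (Fin r) (Fin s) ℂ} {T H : l2 s →L[ℂ] l2 r}
    (hT : ∀ (j : ℕ) (b : Fin s) (i : ℕ) (a : Fin r),
      (T (lp.single 2 j (eVec s b))) i a = if j ≤ i then F (i - j) a b else 0)
    (hH : ∀ (j : ℕ) (b : Fin s) (i : ℕ) (a : Fin r),
      (H (lp.single 2 j (eVec s b))) i a = F (i + j + 1) a b)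
    (x : l2 s) : bwdShift r (T x) = T (bwdShift s x) + H (lp.single 2 0 (x 0)) := by
  refine l2.ext fun i a => ?_
  simp [toeplitz_apply hT, hankel_single_zero_apply hH, Finset.sum_range_succ' _ (i + 1)]

lemma bwdShift_adjoint {r s : ℕ} {T : l2 s →L[ℂ] l2 r}
    (hTS : ∀ x, T (fwdShift s x) = fwdShift r (T x)) (y : l2 r) :
    bwdShift s (T.adjoint y) = T.adjoint (bwdShift r y) := by
  refine ext_inner_left ℂ fun x => ?_
  rw [← inner_fwdShift_left, ContinuousLinearMap.adjoint_inner_right, hTS, inner_fwdShift_left,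
    ContinuousLinearMap.adjoint_inner_right]

lemma l2.clm_single {n j : ℕ} (φ : l2 n →L[ℂ] ℂ) (v : ES n) :
    φ (lp.single 2 j v) = ∑ b, v b * φ (lp.single 2 j (eVec n b)) := by
  have h := l2.hasSum_clm_apply φ (lp.single 2 j v)
  rw [h.unique (hasSum_single j fun i hi => ?_)]
  · simp
  · simp [lp.single_apply, hi]

lemma l2.clm_single_apply {r s i j : ℕ} (L : l2 s →L[ℂ] l2 r) (v : ES s) (a : Fin r) :
    L (lp.single 2 j v) i a = ∑ b, v b * L (lp.single 2 j (eVec s b)) i a :=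
  l2.clm_single ((coordCLM r i a).comp L) v

lemma l2.inner_single_right {n j : ℕ} (v : ES n) (x : l2 n) :
    inner ℂ x (lp.single 2 j v : l2 n) = inner ℂ (x j) v :=
  lp.inner_single_right (G := fun _ : ℕ => ES n) j v x

section Wandering

variable {n k : ℕ} {E : Type*} [NormedAddCommGroup E] [InnerProductSpace ℂ E]
  {T : l2 n →L[ℂ] l2 k} (hTS : ∀ x, T (fwdShift n x) = fwdShift k (T x))

include hTS in
lemma map_fwdShiftPow_eq_zero {x : l2 n} (hx : T x = 0) (j : ℕ) : T (fwdShiftPow n j x) = 0 := by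
  induction j with
  | zero => simpa using hx
  | succ j ih => rw [fwdShiftPow_succ, hTS, ih, map_zero]

variable {J : E →ₗᵢ[ℂ] l2 n} (hJ : ∀ w, T (J w) = 0)
  (hJS : ∀ x, T x = 0 → ∀ w, inner ℂ (fwdShift n x) (J w) = 0)

include hTS hJS in
lemma inner_fwdShiftPow_add {x : l2 n} (hx : T x = 0) (w : E) (i d : ℕ) :
    inner ℂ (fwdShiftPow n (i + d + 1) x) (fwdShiftPow n i (J w)) = 0 := by
  induction i with
  | zero =>
    rw [fwdShiftPow_succ]
    exact hJS _ (map_fwdShiftPow_eq_zero hTS hx _) w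
  | succ i ih =>
    rw [show i + 1 + d + 1 = (i + d + 1) + 1 by ring, fwdShiftPow_succ _ x,
      fwdShiftPow_succ _ (J w), LinearIsometry.inner_map_map]
    exact ih

include hTS hJ hJS in
/-- A wandering subspace of the shift yields an orthogonal family. -/
lemma orthogonalFamily_fwdShiftPow :
    OrthogonalFamily ℂ (fun _ : ℕ => E) fun j => (fwdShiftPow n j).comp J := by
  have key : ∀ {i j : ℕ}, i < j → ∀ v w : E,
      inner ℂ (fwdShiftPow n j (J v)) (fwdShiftPow n i (J w)) = 0 := by
    intro i j hij v w
    obtain ⟨d, rfl⟩ := Nat.exists_eq_add_of_lt hij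
    exact inner_fwdShiftPow_add hTS hJS (hJ v) w i d
  intro i j hij v w
  rcases lt_or_gt_of_ne hij with h | h
  · exact inner_eq_zero_symm.1 (key h w v)
  · exact key h v w

include hTS in
lemma eq_zero_of_inner_fwdShiftPow_eq_zero
    (hJ0 : ∀ x, T x = 0 → (∀ w, inner ℂ (J w) x = 0) → x 0 = 0) {x : l2 n} (hx : T x = 0)
    (hxJ : ∀ j w, inner ℂ (fwdShiftPow n j (J w)) x = 0) : x = 0 := by
  have key : ∀ (ν : ℕ) (x : l2 n), T x = 0 →
      (∀ j w, inner ℂ (fwdShiftPow n j (J w)) x = 0) → x ν = 0 := by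
    intro ν
    induction ν with
    | zero => exact fun x hx hxJ => hJ0 x hx fun w => by simpa using hxJ 0 w
    | succ ν ih =>
      intro x hx hxJ
      have h0 : x 0 = 0 := hJ0 x hx fun w => by simpa using hxJ 0 w
      have hxS : fwdShift n (bwdShift n x) = x := by
        simpa [h0] using single_add_fwdShift_bwdShift x
      rw [← bwdShift_apply]
      refine ih _ ?_ fun j w => ?_
      · apply (fwdShift k).injective
        rw [← hTS, hxS, hx, map_zero]
      · rw [← inner_fwdShift_left, ← fwdShiftPow_succ]
        exact hxJ (j + 1) w
  apply lp.ext
  funext ν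
  exact key ν x hx hxJ

include hTS hJ hJS in
/-- Beurling's theorem for the kernel of an operator commuting with the shift,
given an isometric parametrization `J` of the wandering subspace. -/
lemma exists_isometry_range_eq_ker [CompleteSpace E]
    (hJ0 : ∀ x, T x = 0 → (∀ w, inner ℂ (J w) x = 0) → x 0 = 0) :
    ∃ U : lp (fun _ : ℕ => E) 2 →ₗᵢ[ℂ] l2 n,
      (∀ j w, U (lp.single 2 j w) = fwdShiftPow n j (J w)) ∧ Set.range U = {x | T x = 0} := by
  have hV := orthogonalFamily_fwdShiftPow hTS hJ hJS
  have hs : ∀ j w, hV.linearIsometry (lp.single 2 j w) = fwdShiftPow n j (J w) :=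
    fun j w => hV.linearIsometry_apply_single w
  set U := hV.linearIsometry
  have hTU : ∀ y, T (U y) = 0 := by
    intro y
    refine ((hV.hasSum_linearIsometry y).mapL T).unique ?_
    convert! hasSum_zero with j
    exact map_fwdShiftPow_eq_zero hTS (hJ (y j)) j
  refine ⟨U, hs, Set.Subset.antisymm ?_ fun x hx => ?_⟩
  · rintro _ ⟨y, rfl⟩
    exact hTU y
  · let y := U.toContinuousLinearMap.adjoint x
    have hy : ∀ z, inner ℂ (U z) (x - U y) = 0 := by
      intro z
      rw [inner_sub_right, LinearIsometry.inner_map_map]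
      exact sub_eq_zero.2 (ContinuousLinearMap.adjoint_inner_right U.toContinuousLinearMap z x).symm
    refine ⟨y, (sub_eq_zero.1 ?_).symm⟩
    refine eq_zero_of_inner_fwdShiftPow_eq_zero hTS hJ0 ?_ fun j w => ?_
    · rw [map_sub, hTU, sub_zero]
      exact hx
    · rw [← hs]
      exact hy _

end Wandering

lemma mulES_mul {q r s : ℕ} (M : Matrix (Fin q) (Fin r) ℂ) (N : Matrix (Fin r) (Fin s) ℂ)
    (v : ES s) : mulES (M * N) v = mulES M (mulES N v) := by
  simp [mulES]

lemma inner_mulES_left {r s : ℕ} (M : Matrix (Fin r) (Fin s) ℂ) (v : ES s) (w : ES r) :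
    inner ℂ (mulES M v) w = inner ℂ v (mulES Mᴴ w) := by
  simp only [mulES, EuclideanSpace.inner_eq_star_dotProduct]
  rw [Matrix.star_mulVec, dotProduct_comm, ← Matrix.dotProduct_mulVec, dotProduct_comm]

open scoped ComplexOrder in
lemma mulES_conjTranspose_surjective {r s : ℕ} {M : Matrix (Fin r) (Fin s) ℂ}
    (hM : ∀ w : Fin s → ℂ, M.mulVec w = 0 → w = 0) : Function.Surjective (mulES Mᴴ) := by
  have hinj : Function.Injective (Mᴴ * M).mulVec := by
    intro x y hxy
    rw [← sub_eq_zero, ← Matrix.mulVec_sub] at hxy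
    exact sub_eq_zero.1 (hM _ ((Matrix.conjTranspose_mul_self_mulVec_eq_zero M _).1 hxy))
  have hsurj := Matrix.mulVec_surjective_iff_isUnit.2 (Matrix.mulVec_injective_iff_isUnit.1 hinj)
  intro w
  obtain ⟨v, hv⟩ := hsurj w
  exact ⟨mulES M (WithLp.toLp 2 v), by rw [← mulES_mul]; exact congrArg (WithLp.toLp 2) hv⟩

section BezoutOperators

variable {m p : ℕ} {T H : l2 p →L[ℂ] l2 m} {R : l2 m →L[ℂ] l2 m}

/-- The coefficient sequence of `Y(·)v`, for `Y(z) = I - z E*(I - z S*)⁻¹ T* R H E`. -/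
def bezoutY (T H : l2 p →L[ℂ] l2 m) (R : l2 m →L[ℂ] l2 m) : ES p →ₗ[ℂ] l2 p :=
  let ι : ES p →ₗ[ℂ] l2 p := lp.lsingle (E := fun _ : ℕ => ES p) 2 0
  ι - (fwdShift p).toLinearMap ∘ₗ T.adjoint.toLinearMap ∘ₗ R.toLinearMap ∘ₗ H.toLinearMap ∘ₗ ι

lemma bezoutY_apply (v : ES p) : bezoutY T H R v =
    lp.single 2 0 v - fwdShift p (T.adjoint (R (H (lp.single 2 0 v)))) := rfl

lemma bezoutY_coeff {Yc : ℕ → Matrix (Fin p) (Fin p) ℂ} (hYc0 : Yc 0 = 1)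
    (hYc : ∀ (ν : ℕ) (a b : Fin p),
      Yc (ν + 1) a b = -(T.adjoint (R (H (lp.single 2 0 (eVec p b))))) ν a)
    (v : ES p) (ν : ℕ) : bezoutY T H R v ν = mulES (Yc ν) v := by
  ext a
  rw [bezoutY_apply, mulES_apply]
  cases ν with
  | zero => simp [hYc0, Matrix.one_apply]
  | succ ν =>
    have h := l2.clm_single_apply (i := ν) (j := 0) (T.adjoint ∘L R ∘L H) v a
    simp only [ContinuousLinearMap.comp_apply] at h
    simp [lp.single_apply, h, hYc, mul_comm]

/-- Elements whose backward shift lies in the range of `T* R T` are determined by `Y`. -/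
lemma eq_bezoutY_of_bwdShift
    (hTH : ∀ x, bwdShift m (T x) = T (bwdShift p x) + H (lp.single 2 0 (x 0)))
    {x : l2 p} (hx : bwdShift m (T x) = 0)
    (hfix : T.adjoint (R (T (bwdShift p x))) = bwdShift p x) :
    x = bezoutY T H R (x 0) := by
  have h1 : T (bwdShift p x) = -H (lp.single 2 0 (x 0)) := by
    rw [hTH] at hx
    exact eq_neg_of_add_eq_zero_left hx
  conv_lhs => rw [← single_add_fwdShift_bwdShift x, ← hfix, h1]
  simp only [bezoutY_apply, map_neg, sub_eq_add_neg]

variable (hTS : ∀ x, T (fwdShift p x) = fwdShift m (T x))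
  (hTH : ∀ x, bwdShift m (T x) = T (bwdShift p x) + H (lp.single 2 0 (x 0)))
  (hR1 : ∀ x, R (T (T.adjoint x)) = x) (hR2 : ∀ x, T (T.adjoint (R x)) = x)

include hTS hTH hR1 hR2 in
lemma adjoint_eq_bezoutY (u : ES m) : T.adjoint (R (lp.single 2 0 u))
    = bezoutY T H R (T.adjoint (R (lp.single 2 0 u)) 0) := by
  apply eq_bezoutY_of_bwdShift hTH
  · refine l2.ext fun ν a => ?_
    simp [hR2, lp.single_apply]
  · rw [bwdShift_adjoint hTS, hR1]

include hTH hR2 in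
lemma eq_bezoutY_of_wandering {x : l2 p} (hx : T x = 0)
    (hxS : ∀ y, T y = 0 → inner ℂ (fwdShift p y) x = 0) : x = bezoutY T H R (x 0) := by
  apply eq_bezoutY_of_bwdShift hTH
  · rw [hx, map_zero]
  · set d := bwdShift p x - T.adjoint (R (T (bwdShift p x))) with hd
    have hTd : T d = 0 := by rw [hd, map_sub, hR2, sub_self]
    have h : inner ℂ d d = (0 : ℂ) := by
      conv_lhs => rw [hd]
      rw [← hd, inner_sub_right, ContinuousLinearMap.adjoint_inner_right, hTd, inner_zero_left,
        ← inner_fwdShift_left, hxS d hTd, sub_zero]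
    exact (sub_eq_zero.1 (hd ▸ inner_self_eq_zero.1 h)).symm

/-- The compression to `ker T` of the constant `v`, for `R = (T T*)⁻¹`. -/
def kerConst (T : l2 p →L[ℂ] l2 m) (R : l2 m →L[ℂ] l2 m) (v : ES p) : l2 p :=
  lp.single 2 0 v - T.adjoint (R (T (lp.single 2 0 v)))

include hR2 in
lemma map_kerConst (v : ES p) : T (kerConst T R v) = 0 := by
  rw [kerConst, map_sub, hR2, sub_self]

lemma inner_kerConst {x : l2 p} (hx : T x = 0) (v : ES p) :
    inner ℂ x (kerConst T R v) = inner ℂ (x 0) v := by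
  rw [kerConst, inner_sub_right, ContinuousLinearMap.adjoint_inner_right, hx, inner_zero_left,
    sub_zero, l2.inner_single_right]

include hTS in
lemma inner_fwdShift_kerConst {x : l2 p} (hx : T x = 0) (v : ES p) :
    inner ℂ (fwdShift p x) (kerConst T R v) = 0 := by
  rw [inner_kerConst (by rw [hTS, hx, map_zero])]
  simp

include hTS hTH hR2 in
lemma kerConst_eq_bezoutY (v : ES p) :
    kerConst T R v = bezoutY T H R (kerConst T R v 0) :=
  eq_bezoutY_of_wandering hTH hR2 (map_kerConst hR2 v)
    fun _ hy => inner_fwdShift_kerConst hTS hy v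

lemma kerConst_zero {q : ℕ} {Θ₀ : Matrix (Fin p) (Fin q) ℂ}
    (hΘ₀ : ∀ (a b : Fin p), (Θ₀ * Θ₀ᴴ) a b
      = (if a = b then 1 else 0) - (T.adjoint (R (T (lp.single 2 0 (eVec p b))))) 0 a)
    (v : ES p) : kerConst T R v 0 = mulES Θ₀ (mulES Θ₀ᴴ v) := by
  rw [← mulES_mul]
  ext a
  have h := l2.clm_single_apply (i := 0) (j := 0) (T.adjoint ∘L R ∘L T) v a
  simp only [ContinuousLinearMap.comp_apply] at h
  rw [mulES_apply]
  simp [kerConst, h, hΘ₀, mul_comm, mul_sub, Finset.sum_sub_distrib]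

include hTS hTH hR2 in
/-- The isometric parametrization `w ↦ Y Θ₀ w` of the wandering subspace of `ker T`. -/
lemma exists_wandering_isometry {q : ℕ} {Θ₀ : Matrix (Fin p) (Fin q) ℂ}
    (hker : ∀ w : Fin q → ℂ, Θ₀.mulVec w = 0 → w = 0)
    (hΘ₀ : ∀ (a b : Fin p), (Θ₀ * Θ₀ᴴ) a b
      = (if a = b then 1 else 0) - (T.adjoint (R (T (lp.single 2 0 (eVec p b))))) 0 a) :
    ∃ J : ES q →ₗᵢ[ℂ] l2 p, (∀ w, J w = bezoutY T H R (mulES Θ₀ w)) ∧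
      ∀ v, J (mulES Θ₀ᴴ v) = kerConst T R v := by
  have hJ : ∀ v, bezoutY T H R (mulES Θ₀ (mulES Θ₀ᴴ v)) = kerConst T R v := fun v => by
    rw [← kerConst_zero hΘ₀, ← kerConst_eq_bezoutY hTS hTH hR2]
  refine ⟨⟨⟨⟨fun w => bezoutY T H R (mulES Θ₀ w), ?_⟩, ?_⟩, ?_⟩, fun _ => rfl, hJ⟩
  · intro v w
    refine .trans ?_ (map_add (bezoutY T H R) _ _)
    exact congrArg (bezoutY T H R) (congrArg (WithLp.toLp 2) (Matrix.mulVec_add Θ₀ v.ofLp w.ofLp))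
  · intro c w
    refine .trans ?_ (map_smul (bezoutY T H R) _ _)
    exact congrArg (bezoutY T H R) (congrArg (WithLp.toLp 2) (Matrix.mulVec_smul Θ₀ c w.ofLp))
  · intro w
    obtain ⟨v, rfl⟩ := mulES_conjTranspose_surjective hker w
    change ‖bezoutY T H R (mulES Θ₀ (mulES Θ₀ᴴ v))‖ = _
    have h : inner ℂ (kerConst T R v) (kerConst T R v)
        = inner ℂ (mulES Θ₀ᴴ v) (mulES Θ₀ᴴ v) := by
      rw [inner_kerConst (map_kerConst hR2 v), kerConst_zero hΘ₀, inner_mulES_left]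
    rw [hJ, @norm_eq_sqrt_re_inner ℂ, h, ← @norm_eq_sqrt_re_inner ℂ]

include hTS hTH hR2 in
/-- The inner function `Y Θ₀` parametrizes `ker T`. -/
lemma exists_inner_isometry {q : ℕ} {Θ₀ : Matrix (Fin p) (Fin q) ℂ}
    (hker : ∀ w : Fin q → ℂ, Θ₀.mulVec w = 0 → w = 0)
    (hΘ₀ : ∀ (a b : Fin p), (Θ₀ * Θ₀ᴴ) a b
      = (if a = b then 1 else 0) - (T.adjoint (R (T (lp.single 2 0 (eVec p b))))) 0 a) :
    ∃ U : l2 q →ₗᵢ[ℂ] l2 p,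
      (∀ j w, U (lp.single 2 j w) = fwdShiftPow p j (bezoutY T H R (mulES Θ₀ w))) ∧
      Set.range U = {x | T x = 0} := by
  obtain ⟨J, hJ, hJv⟩ := exists_wandering_isometry hTS hTH hR2 hker hΘ₀
  have hsurj := mulES_conjTranspose_surjective hker
  simp_rw [← hJ]
  refine exists_isometry_range_eq_ker hTS (fun w => ?_) (fun x hx w => ?_) fun x hx h => ?_
  · obtain ⟨v, rfl⟩ := hsurj w
    rw [hJv, map_kerConst hR2]
  · obtain ⟨v, rfl⟩ := hsurj w
    rw [hJv, inner_fwdShift_kerConst hTS hx]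
  · refine ext_inner_right ℂ fun v => ?_
    rw [← inner_kerConst (R := R) hx, ← hJv, inner_zero_left]
    exact inner_eq_zero_symm.1 (h _)

end BezoutOperators

lemma summable_norm_pow_mul {f : ℕ → ℂ} (hf : Summable fun ν => ‖f ν‖ ^ 2) {z : ℂ}
    (hz : z ∈ Metric.ball (0 : ℂ) 1) : Summable fun ν => ‖z ^ ν * f ν‖ := by
  have hz1 : ‖z‖ < 1 := by simpa using hz
  have hg : Summable fun ν : ℕ => (‖z‖ ^ 2) ^ ν :=
    summable_geometric_of_lt_one (by positivity) (by nlinarith [norm_nonneg z])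
  refine (hg.add hf).of_nonneg_of_le (fun _ => norm_nonneg _) fun ν => ?_
  rw [norm_mul, norm_pow, ← pow_mul, mul_comm 2 ν, pow_mul]
  nlinarith [sq_nonneg (‖z‖ ^ ν - ‖f ν‖), sq_nonneg (‖z‖ ^ ν), sq_nonneg ‖f ν‖]

lemma eq_of_tsum_pow_mul_eq {f g : ℕ → ℂ} (hf : Summable fun ν => ‖f ν‖ ^ 2)
    (hg : Summable fun ν => ‖g ν‖ ^ 2)
    (h : ∀ z ∈ Metric.ball (0 : ℂ) 1, ∑' ν, z ^ ν * f ν = ∑' ν, z ^ ν * g ν) : f = g := by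
  have key : ∀ {e : ℕ → ℂ}, (Summable fun ν => ‖e ν‖ ^ 2) →
      HasFPowerSeriesAt (fun z => ∑' ν, z ^ ν * e ν)
        (FormalMultilinearSeries.ofScalars ℂ e) 0 := by
    intro e he
    rw [hasFPowerSeriesAt_iff]
    filter_upwards [Metric.ball_mem_nhds (0 : ℂ) one_pos] with z hz
    simpa using (summable_norm_pow_mul he hz).of_norm.hasSum
  have hfg : (fun z => ∑' ν, z ^ ν * f ν) =ᶠ[nhds 0] fun z => ∑' ν, z ^ ν * g ν := by
    filter_upwards [Metric.ball_mem_nhds (0 : ℂ) one_pos] with z hz using h z hz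
  have he := ((key hf).congr hfg).eq_formalMultilinearSeries (key hg)
  funext ν
  simpa using congrArg (fun q => FormalMultilinearSeries.coeff q ν) he

/-- Square-summability of all entries of a coefficient sequence, i.e. membership in `H²`. -/
def SqSummable {r s : ℕ} (F : ℕ → Matrix (Fin r) (Fin s) ℂ) : Prop :=
  ∀ a b, Summable fun ν => ‖F ν a b‖ ^ 2

lemma seriesM_injective {r s : ℕ} {F K : ℕ → Matrix (Fin r) (Fin s) ℂ} (hF : SqSummable F)
    (hK : SqSummable K) (h : ∀ z ∈ Metric.ball (0 : ℂ) 1, seriesM F z = seriesM K z) : F = K := by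
  funext ν
  ext a b
  exact congrFun (eq_of_tsum_pow_mul_eq (hF a b) (hK a b)
    fun z hz => congrFun (congrFun (h z hz) a) b) ν

lemma seriesM_add {r s : ℕ} {F K : ℕ → Matrix (Fin r) (Fin s) ℂ} (hF : SqSummable F)
    (hK : SqSummable K) {z : ℂ} (hz : z ∈ Metric.ball (0 : ℂ) 1) :
    seriesM (fun ν => F ν + K ν) z = seriesM F z + seriesM K z := by
  ext a b
  simp only [seriesM, Matrix.of_apply, Matrix.add_apply, mul_add]
  exact (summable_norm_pow_mul (hF a b) hz).of_norm.tsum_add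
    (summable_norm_pow_mul (hK a b) hz).of_norm

lemma seriesM_mul_const {r s t : ℕ} {F : ℕ → Matrix (Fin r) (Fin s) ℂ} (hF : SqSummable F)
    (M : Matrix (Fin s) (Fin t) ℂ) {z : ℂ} (hz : z ∈ Metric.ball (0 : ℂ) 1) :
    seriesM (fun ν => F ν * M) z = seriesM F z * M := by
  ext a b
  simp only [seriesM, Matrix.of_apply, Matrix.mul_apply, Finset.mul_sum, ← tsum_mul_right]
  rw [Summable.tsum_finsetSum]
  · simp_rw [mul_assoc]
  · intro c _
    simpa only [mul_assoc] using (summable_norm_pow_mul (hF a c) hz).of_norm.mul_right (M c b)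

lemma seriesM_const_term {r s : ℕ} (M : Matrix (Fin r) (Fin s) ℂ) (z : ℂ) :
    seriesM (fun ν => if ν = 0 then M else 0) z = M := by
  ext a b
  simp only [seriesM, Matrix.of_apply]
  rw [tsum_eq_single 0 (fun ν hν => by simp [hν])]
  simp

lemma mulES_eVec {r s : ℕ} (M : Matrix (Fin r) (Fin s) ℂ) (a : Fin r) (b : Fin s) :
    mulES M (eVec s b) a = M a b := by
  simp [mulES_apply]

lemma sqSummable_of_coeff {r s : ℕ} {F : ℕ → Matrix (Fin r) (Fin s) ℂ} (x : Fin s → l2 r)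
    (h : ∀ ν a b, F ν a b = x b ν a) : SqSummable F := fun a b => by
  simpa only [h] using l2.summable_coord (x b) a

/-- The `b`-th column of a square-summable matrix sequence. -/
def seqCol {r s : ℕ} (F : ℕ → Matrix (Fin r) (Fin s) ℂ) (hF : SqSummable F) (b : Fin s) : l2 r :=
  l2.ofCoord (fun ν => WithLp.toLp 2 fun a => F ν a b) fun a => hF a b

@[simp] lemma seqCol_apply {r s : ℕ} {F : ℕ → Matrix (Fin r) (Fin s) ℂ} (hF : SqSummable F)
    (b : Fin s) (ν : ℕ) (a : Fin r) : seqCol F hF b ν a = F ν a b := rfl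

/-- The coefficient sequence of `F(·)u`. -/
def seqVec {r s : ℕ} (F : ℕ → Matrix (Fin r) (Fin s) ℂ) (hF : SqSummable F) (u : ES s) : l2 r :=
  ∑ b, u b • seqCol F hF b

lemma seqVec_apply {r s : ℕ} {F : ℕ → Matrix (Fin r) (Fin s) ℂ} (hF : SqSummable F)
    (u : ES s) (ν : ℕ) : seqVec F hF u ν = mulES (F ν) u := by
  ext a
  rw [← coordCLM_apply, seqVec, map_sum]
  simp [mulES_apply, mul_comm]

lemma seqVec_eVec {r s : ℕ} {F : ℕ → Matrix (Fin r) (Fin s) ℂ} (hF : SqSummable F)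
    (b : Fin s) : seqVec F hF (eVec s b) = seqCol F hF b :=
  l2.ext fun ν a => by rw [seqVec_apply, mulES_eVec, seqCol_apply]

lemma seqVec_eq_sum {r s : ℕ} {F : ℕ → Matrix (Fin r) (Fin s) ℂ} (hF : SqSummable F)
    (u : ES s) : seqVec F hF u = ∑ b, u b • seqVec F hF (eVec s b) := by
  simp only [seqVec_eVec]
  rfl

lemma norm_seqVec_sq {r s : ℕ} {F : ℕ → Matrix (Fin r) (Fin s) ℂ} (hF : SqSummable F)
    (u : Fin s → ℂ) :
    ‖seqVec F hF (WithLp.toLp 2 u)‖ ^ 2 = ∑' ν : ℕ, ∑ a, ‖(F ν).mulVec u a‖ ^ 2 := by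
  rw [l2.norm_sq]
  simp only [seqVec_apply]
  rfl

section Toeplitz

variable {r s t : ℕ} {F : ℕ → Matrix (Fin r) (Fin s) ℂ} {T : l2 s →L[ℂ] l2 r}
  (hT : ∀ (j : ℕ) (b : Fin s) (i : ℕ) (a : Fin r),
    (T (lp.single 2 j (eVec s b))) i a = if j ≤ i then F (i - j) a b else 0)

include hT in
lemma toeplitz_sqSummable : SqSummable F :=
  sqSummable_of_coeff (fun b => T (lp.single 2 0 (eVec s b))) fun ν a b => by simp [hT]

include hT in
/-- Multiplication of `H²` functions by a bounded analytic function is given by the Toeplitz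
operator. -/
lemma seriesM_mul_seriesM {K : ℕ → Matrix (Fin s) (Fin t) ℂ} (hK : SqSummable K) {z : ℂ}
    (hz : z ∈ Metric.ball (0 : ℂ) 1) :
    seriesM F z * seriesM K z
      = seriesM (fun ν => Matrix.of fun a b => T (seqCol K hK b) ν a) z := by
  have hF := toeplitz_sqSummable hT
  ext a b
  have hs : ∀ c, Summable fun ν => ∑ j ∈ Finset.range (ν + 1),
      (z ^ j * K j c b) * (z ^ (ν - j) * F (ν - j) a c) := fun c =>
    (summable_norm_sum_mul_range_of_summable_norm (summable_norm_pow_mul (hK c b) hz)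
      (summable_norm_pow_mul (hF a c) hz)).of_norm
  simp only [seriesM, Matrix.mul_apply, Matrix.of_apply]
  calc _ = ∑ c, ∑' ν, ∑ j ∈ Finset.range (ν + 1),
        (z ^ j * K j c b) * (z ^ (ν - j) * F (ν - j) a c) := by
        refine Finset.sum_congr rfl fun c _ => ?_
        rw [mul_comm]
        exact tsum_mul_tsum_eq_tsum_sum_range_of_summable_norm
          (summable_norm_pow_mul (hK c b) hz) (summable_norm_pow_mul (hF a c) hz)
    _ = ∑' ν, ∑ c, ∑ j ∈ Finset.range (ν + 1),
        (z ^ j * K j c b) * (z ^ (ν - j) * F (ν - j) a c) :=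
        (Summable.tsum_finsetSum fun c _ => hs c).symm
    _ = _ := by
        refine tsum_congr fun ν => ?_
        rw [toeplitz_apply hT, Finset.sum_comm, Finset.mul_sum]
        refine Finset.sum_congr rfl fun j hj => ?_
        rw [Finset.mul_sum]
        refine Finset.sum_congr rfl fun c _ => ?_
        rw [seqCol_apply, ← Nat.add_sub_of_le (Finset.mem_range_succ_iff.1 hj), pow_add,
          Nat.add_sub_cancel_left]
        ring

include hT in
lemma seriesM_mul_eq_iff {K : ℕ → Matrix (Fin s) (Fin t) ℂ} {L : ℕ → Matrix (Fin r) (Fin t) ℂ}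
    (hK : SqSummable K) (hL : SqSummable L) :
    (∀ z ∈ Metric.ball (0 : ℂ) 1, seriesM F z * seriesM K z = seriesM L z) ↔
      ∀ b, T (seqCol K hK b) = seqCol L hL b := by
  have hTK : SqSummable fun ν => Matrix.of fun a b => T (seqCol K hK b) ν a :=
    sqSummable_of_coeff (fun b => T (seqCol K hK b)) fun _ _ _ => rfl
  constructor
  · intro h b
    have := seriesM_injective hTK hL fun z hz => by rw [← seriesM_mul_seriesM hT hK hz, h z hz]
    exact l2.ext fun ν a => congrFun (congrFun (congrFun this ν) a) b
  · intro h z hz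
    rw [seriesM_mul_seriesM hT hK hz]
    congr 1
    funext ν
    ext a b
    simp [h b]

include hT in
lemma seriesM_mul_eq_one_iff {K : ℕ → Matrix (Fin s) (Fin r) ℂ} (hK : SqSummable K) :
    (∀ z ∈ Metric.ball (0 : ℂ) 1, seriesM F z * seriesM K z = 1) ↔
      ∀ u, T (seqVec K hK u) = lp.single 2 0 u := by
  have hx : ∀ (b : Fin r) (ν : ℕ) (a : Fin r),
      (if ν = 0 then (1 : Matrix (Fin r) (Fin r) ℂ) else 0) a b
        = (lp.single 2 0 (eVec r b) : l2 r) ν a := by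
    intro b ν a
    by_cases hν : ν = 0 <;> simp [lp.single_apply, hν, Matrix.one_apply]
  have hL : SqSummable fun ν => if ν = 0 then (1 : Matrix (Fin r) (Fin r) ℂ) else 0 :=
    sqSummable_of_coeff (fun b => lp.single 2 0 (eVec r b)) fun ν a b => hx b ν a
  have hcol : ∀ b, seqCol _ hL b = lp.single 2 0 (eVec r b) := fun b =>
    l2.ext fun ν a => hx b ν a
  have h := seriesM_mul_eq_iff hT hK hL
  simp only [seriesM_const_term, hcol] at h
  rw [h]
  constructor
  · intro h u
    refine l2.ext fun ν a => ?_
    rw [← ContinuousLinearMap.id_apply (R₁ := ℂ) (lp.single 2 0 u : l2 r), l2.clm_single_apply,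
      seqVec, map_sum, ← coordCLM_apply, map_sum]
    simp [h]
  · intro h b
    rw [← seqVec_eVec, h]

include hT in
lemma seriesM_eq_add_mul_iff {X A : ℕ → Matrix (Fin r) (Fin t) ℂ}
    {V : ℕ → Matrix (Fin s) (Fin t) ℂ}
    (hX : SqSummable X) (hA : SqSummable A) (hV : SqSummable V) :
    (∀ z ∈ Metric.ball (0 : ℂ) 1, seriesM X z = seriesM A z + seriesM F z * seriesM V z) ↔
      ∀ u, seqVec X hX u = seqVec A hA u + T (seqVec V hV u) := by
  have hL : SqSummable fun ν => X ν - A ν :=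
    sqSummable_of_coeff (fun b => seqCol X hX b - seqCol A hA b) fun ν a b => by simp
  have hcol : ∀ b, seqCol _ hL b = seqCol X hX b - seqCol A hA b := fun b =>
    l2.ext fun ν a => by simp
  have hser : ∀ z ∈ Metric.ball (0 : ℂ) 1,
      seriesM X z = seriesM A z + seriesM (fun ν => X ν - A ν) z := fun z hz => by
    rw [← seriesM_add hA hL hz]
    simp
  have h := seriesM_mul_eq_iff hT hV hL
  have h' : (∀ z ∈ Metric.ball (0 : ℂ) 1,
      seriesM X z = seriesM A z + seriesM F z * seriesM V z) ↔
      ∀ z ∈ Metric.ball (0 : ℂ) 1,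
        seriesM F z * seriesM V z = seriesM (fun ν => X ν - A ν) z :=
    forall₂_congr fun z hz => by rw [hser z hz, add_right_inj, eq_comm]
  rw [h', h]
  simp only [hcol]
  constructor
  · intro h u
    simp only [seqVec, map_sum, map_smul, h, ← Finset.sum_add_distrib, ← smul_add,
      add_sub_cancel]
  · intro h b
    have := h (eVec t b)
    simp only [seqVec_eVec] at this
    rw [this, add_sub_cancel_left]

end Toeplitz

/-- For `G ∈ H^∞_{m×p}` with `T_G T_G*` strictly positive:
`Ξ(z) = Y(z)Ξ₀` is in `H²_{p×m}` (its coefficients `Y_ν Ξ₀` are square-summable);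
`θ(z) = Y(z)Θ₀` is in `H^∞_{p×(p−m)}` and inner, with `ran T_θ = ker T_G`;
`X = Ξ + θV` solves the `H²`-Bezout problem for every `V ∈ H²_{(p−m)×m}`, every `H²`
solution arises this way, the `H²` identity `‖Xu‖² = ‖Ξu‖² + ‖Vu‖²` holds, and `Ξ` is
the least squares `H²` solution. -/
theorem bezout_corona_stmt17
    (m p : ℕ) (hm : 0 < m) (hmp : m ≤ p)
    (G : ℕ → Matrix (Fin m) (Fin p) ℂ)
    (TG : l2 p →L[ℂ] l2 m)
    (hTG : ∀ (j : ℕ) (b : Fin p) (i : ℕ) (a : Fin m),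
      (TG (lp.single 2 j (eVec p b))) i a = if j ≤ i then G (i - j) a b else 0)
    (HG : l2 p →L[ℂ] l2 m)
    (hHG : ∀ (j : ℕ) (b : Fin p) (i : ℕ) (a : Fin m),
      (HG (lp.single 2 j (eVec p b))) i a = G (i + j + 1) a b)
    (Tinv : l2 m →L[ℂ] l2 m)
    (hT1 : ∀ x, Tinv (TG (TG.adjoint x)) = x)
    (hT2 : ∀ x, TG (TG.adjoint (Tinv x)) = x)
    (Ξ₀ : Matrix (Fin p) (Fin m) ℂ)
    (hΞ₀ : ∀ (a : Fin p) (b : Fin m),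
      Ξ₀ a b = (TG.adjoint (Tinv (lp.single 2 0 (eVec m b)))) 0 a)
    (Θ₀ : Matrix (Fin p) (Fin (p - m)) ℂ)
    (hΘ₀ker : ∀ w : Fin (p - m) → ℂ, Θ₀.mulVec w = 0 → w = 0)
    (hΘ₀ : ∀ (a b : Fin p), (Θ₀ * Θ₀ᴴ) a b
      = (if a = b then 1 else 0) - (TG.adjoint (Tinv (TG (lp.single 2 0 (eVec p b))))) 0 a)
    (Yc : ℕ → Matrix (Fin p) (Fin p) ℂ)
    (hYc0 : Yc 0 = 1)
    (hYc : ∀ (ν : ℕ) (a b : Fin p),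
      Yc (ν + 1) a b = -(TG.adjoint (Tinv (HG (lp.single 2 0 (eVec p b))))) ν a) :
    -- `Ξ ∈ H²_{p×m}`
    (∀ (a : Fin p) (b : Fin m), Summable fun ν => ‖(Yc ν * Ξ₀) a b‖ ^ 2) ∧
    -- `θ ∈ H^∞_{p×(p−m)}` is inner with `ran T_θ = ker T_G`
    (∃ Tθ : l2 (p - m) →L[ℂ] l2 p,
      (∀ (j : ℕ) (b : Fin (p - m)) (i : ℕ) (a : Fin p),
        (Tθ (lp.single 2 j (eVec (p - m) b))) i a
          = if j ≤ i then (Yc (i - j) * Θ₀) a b else 0) ∧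
      (∀ x, ‖Tθ x‖ = ‖x‖) ∧
      Set.range Tθ = {x : l2 p | TG x = 0}) ∧
    -- every `H²` parameter `V` produces an `H²` solution, with the `H²` norm identity
    (∀ Vc : ℕ → Matrix (Fin (p - m)) (Fin m) ℂ,
      (∀ a b, Summable fun ν => ‖Vc ν a b‖ ^ 2) →
      (∃ Xc : ℕ → Matrix (Fin p) (Fin m) ℂ,
        (∀ a b, Summable fun ν => ‖Xc ν a b‖ ^ 2) ∧
        ∀ z ∈ Metric.ball (0 : ℂ) 1,
          seriesM Xc z = seriesM Yc z * Ξ₀ + seriesM Yc z * Θ₀ * seriesM Vc z) ∧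
      (∀ z ∈ Metric.ball (0 : ℂ) 1,
        seriesM G z * (seriesM Yc z * Ξ₀ + seriesM Yc z * Θ₀ * seriesM Vc z) = 1) ∧
      (∀ Xc : ℕ → Matrix (Fin p) (Fin m) ℂ,
        (∀ a b, Summable fun ν => ‖Xc ν a b‖ ^ 2) →
        (∀ z ∈ Metric.ball (0 : ℂ) 1,
          seriesM Xc z = seriesM Yc z * Ξ₀ + seriesM Yc z * Θ₀ * seriesM Vc z) →
        ∀ u : Fin m → ℂ,
          (∑' ν : ℕ, ∑ a, ‖(Xc ν).mulVec u a‖ ^ 2)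
            = (∑' ν : ℕ, ∑ a, ‖(Yc ν * Ξ₀).mulVec u a‖ ^ 2)
              + ∑' ν : ℕ, ∑ a, ‖(Vc ν).mulVec u a‖ ^ 2)) ∧
    -- every `H²` solution arises this way, and `Ξ` is the least squares solution
    (∀ Xc : ℕ → Matrix (Fin p) (Fin m) ℂ,
      (∀ a b, Summable fun ν => ‖Xc ν a b‖ ^ 2) →
      (∀ z ∈ Metric.ball (0 : ℂ) 1, seriesM G z * seriesM Xc z = 1) →
      (∃ Vc : ℕ → Matrix (Fin (p - m)) (Fin m) ℂ,
        (∀ a b, Summable fun ν => ‖Vc ν a b‖ ^ 2) ∧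
        ∀ z ∈ Metric.ball (0 : ℂ) 1,
          seriesM Xc z = seriesM Yc z * Ξ₀ + seriesM Yc z * Θ₀ * seriesM Vc z) ∧
      (∀ u : Fin m → ℂ,
        (∑' ν : ℕ, ∑ a, ‖(Yc ν * Ξ₀).mulVec u a‖ ^ 2)
          ≤ ∑' ν : ℕ, ∑ a, ‖(Xc ν).mulVec u a‖ ^ 2)) := by
  have hTS := toeplitz_fwdShift hTG
  have hTH := bwdShift_toeplitz hTG hHG
  obtain ⟨U, hU, hUran⟩ := exists_inner_isometry hTS hTH hT2 hΘ₀ker hΘ₀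
  have hYv := bezoutY_coeff (T := TG) (H := HG) (R := Tinv) hYc0 hYc
  have hY : SqSummable Yc := sqSummable_of_coeff (fun b => bezoutY TG HG Tinv (eVec p b))
    fun ν a b => by rw [hYv, mulES_eVec]
  have hΞ : SqSummable fun ν => Yc ν * Ξ₀ :=
    sqSummable_of_coeff (fun b => bezoutY TG HG Tinv (mulES Ξ₀ (eVec m b)))
      fun ν a b => by rw [hYv, ← mulES_mul, mulES_eVec]
  have hΞvec : ∀ u, seqVec _ hΞ u = TG.adjoint (Tinv (lp.single 2 0 u)) := by
    intro u
    have h0 : TG.adjoint (Tinv (lp.single 2 0 u)) 0 = mulES Ξ₀ u := by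
      ext a
      have h := l2.clm_single_apply (i := 0) (j := 0) (TG.adjoint ∘L Tinv) u a
      simp only [ContinuousLinearMap.comp_apply] at h
      simp [h, mulES_apply, hΞ₀, mul_comm]
    rw [adjoint_eq_bezoutY hTS hTH hT1 hT2, h0]
    refine l2.ext fun ν a => ?_
    rw [seqVec_apply, mulES_mul, hYv]
  have hTΞ : ∀ u, TG (seqVec _ hΞ u) = lp.single 2 0 u := fun u => by rw [hΞvec, hT2]
  have hUbasis : ∀ (j : ℕ) (b : Fin (p - m)) (i : ℕ) (a : Fin p),
      (U.toContinuousLinearMap (lp.single 2 j (eVec (p - m) b))) i a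
        = if j ≤ i then (Yc (i - j) * Θ₀) a b else 0 := by
    intro j b i a
    rw [LinearIsometry.coe_toContinuousLinearMap, hU, fwdShiftPow_apply, hYv, ← mulES_mul,
      mulES_eVec]
  have hTU : ∀ y, TG (U y) = 0 := fun y =>
    (Set.ext_iff.1 hUran (U y)).1 ⟨y, rfl⟩
  have hpyth : ∀ (u : ES m) (y : l2 (p - m)),
      ‖seqVec _ hΞ u + U y‖ ^ 2 = ‖seqVec _ hΞ u‖ ^ 2 + ‖y‖ ^ 2 := by
    intro u y
    have h : inner ℂ (seqVec _ hΞ u) (U y) = (0 : ℂ) := by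
      rw [hΞvec, ContinuousLinearMap.adjoint_inner_left, hTU, inner_zero_right]
    rw [sq, norm_add_sq_eq_norm_sq_add_norm_sq_of_inner_eq_zero _ _ h, U.norm_map, sq, sq]
  have hiff : ∀ {Xc : ℕ → Matrix (Fin p) (Fin m) ℂ} {Vc : ℕ → Matrix (Fin (p - m)) (Fin m) ℂ}
      (hX : SqSummable Xc) (hV : SqSummable Vc),
      (∀ z ∈ Metric.ball (0 : ℂ) 1,
        seriesM Xc z = seriesM Yc z * Ξ₀ + seriesM Yc z * Θ₀ * seriesM Vc z) ↔
      ∀ u, seqVec Xc hX u = seqVec _ hΞ u + U (seqVec Vc hV u) := by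
    intro Xc Vc hX hV
    refine Iff.trans (forall₂_congr fun z hz => ?_)
      (seriesM_eq_add_mul_iff (F := fun ν => Yc ν * Θ₀) hUbasis hX hΞ hV)
    rw [seriesM_mul_const hY Ξ₀ hz, seriesM_mul_const hY Θ₀ hz]
  have hext : ∀ {Xc : ℕ → Matrix (Fin p) (Fin m) ℂ} {Vc : ℕ → Matrix (Fin (p - m)) (Fin m) ℂ}
      (hX : SqSummable Xc) (hV : SqSummable Vc),
      (∀ b, seqVec Xc hX (eVec m b) = seqVec _ hΞ (eVec m b) + U (seqVec Vc hV (eVec m b))) →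
      ∀ u, seqVec Xc hX u = seqVec _ hΞ u + U (seqVec Vc hV u) := by
    intro Xc Vc hX hV h u
    rw [seqVec_eq_sum hX, seqVec_eq_sum hΞ, seqVec_eq_sum hV]
    simp only [h, map_sum, map_smul, ← Finset.sum_add_distrib, ← smul_add]
  refine ⟨hΞ, ⟨U.toContinuousLinearMap, hUbasis, U.norm_map, hUran⟩, fun Vc hV => ?_,
    fun Xc hX hGX => ?_⟩
  · have hsol : SqSummable fun ν => Matrix.of fun a b =>
        (seqVec _ hΞ (eVec m b) + U (seqVec Vc hV (eVec m b))) ν a :=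
      sqSummable_of_coeff (fun b => seqVec _ hΞ (eVec m b) + U (seqVec Vc hV (eVec m b)))
        fun _ _ _ => rfl
    have hsolvec : ∀ u, seqVec _ hsol u = seqVec _ hΞ u + U (seqVec Vc hV u) :=
      hext hsol hV fun b => seqVec_eVec hsol b
    have hsolser := (hiff hsol hV).2 hsolvec
    refine ⟨⟨_, hsol, hsolser⟩, fun z hz => ?_, fun Xc hX hXser u => ?_⟩
    · rw [← hsolser z hz]
      refine (seriesM_mul_eq_one_iff hTG hsol).2 (fun u => ?_) z hz
      rw [hsolvec, map_add, hTU, hTΞ, add_zero]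
    · rw [← norm_seqVec_sq hX, ← norm_seqVec_sq hV, ← norm_seqVec_sq hΞ,
        (hiff hX hV).1 hXser, hpyth]
  · have hTX := (seriesM_mul_eq_one_iff hTG hX).1 hGX
    have hex : ∀ u, ∃ y, U y = seqVec Xc hX u - seqVec _ hΞ u := fun u =>
      (Set.ext_iff.1 hUran _).2 (by
        rw [Set.mem_ofPred_eq, map_sub, hTX, hTΞ, sub_self])
    choose y hy using hex
    have hV : SqSummable fun ν => Matrix.of fun c b => y (eVec m b) ν c :=
      sqSummable_of_coeff (fun b => y (eVec m b)) fun _ _ _ => rfl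
    refine ⟨⟨_, hV, (hiff hX hV).2 (hext hX hV fun b => ?_)⟩, fun u => ?_⟩
    · have hcol : seqCol _ hV b = y (eVec m b) := rfl
      rw [seqVec_eVec hV, hcol, hy, add_sub_cancel]
    · rw [← norm_seqVec_sq hX, ← norm_seqVec_sq hΞ,
        ← add_sub_cancel (seqVec _ hΞ (WithLp.toLp 2 u)) (seqVec Xc hX (WithLp.toLp 2 u)), ← hy,
        hpyth]
      exact le_add_of_nonneg_right (sq_nonneg _)
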